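/- arXiv:1612.06599 — 9 statements merged into one kernel-verified Lean document; each statement's English description precedes it below -/
import Mathlib

section
/- Let N be a finite set and m a supermodular set function on N. Define m^{max⊆}(S) := max{ m(T) : T ⊆ S } and m^{max⊇}(S) := max{ m(T) : S ⊆ T ⊆ N } for S ⊆ N. Then m^{max⊆} is a supermodular set function on N which is non-decreasing with respect to inclusion, and m^{max⊇} is a supermodular set function on N which is non-increasing with respect to inclusion. -/
/-- A set function `m` on the finite set `N` is supermodular if
`m A + m B ≤ m (A ∪ B) + m (A ∩ B)` for all `A, B ⊆ N`. -/
def Supermodular {α : Type*} [DecidableEq α] (N : Finset α) (m : Finset α → ℝ) : Prop :=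
  ∀ A ⊆ N, ∀ B ⊆ N, m A + m B ≤ m (A ∪ B) + m (A ∩ B)

/-- `maxSub m S = max { m T : T ⊆ S }`. -/
noncomputable def maxSub {α : Type*} [DecidableEq α] (m : Finset α → ℝ) (S : Finset α) : ℝ :=
  (S.powerset.image m).max'
    (Finset.Nonempty.image ⟨∅, Finset.empty_mem_powerset S⟩ m)

/-- `maxSup N m S = max { m T : S ⊆ T ⊆ N }` (for `S ⊆ N`), realized as the
maximum of `m (S ∪ L)` over `L ⊆ N ∖ S`. -/
noncomputable def maxSup {α : Type*} [DecidableEq α] (N : Finset α) (m : Finset α → ℝ)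
    (S : Finset α) : ℝ :=
  ((N \ S).powerset.image (fun L => m (S ∪ L))).max'
    (Finset.Nonempty.image ⟨∅, Finset.empty_mem_powerset _⟩ _)

theorem le_maxSub {α : Type*} [DecidableEq α] (m : Finset α → ℝ) {S T : Finset α}
    (h : T ⊆ S) : m T ≤ maxSub m S :=
  Finset.le_max' _ _ (Finset.mem_image_of_mem m (Finset.mem_powerset.2 h))

theorem exists_subset_maxSub_eq {α : Type*} [DecidableEq α] (m : Finset α → ℝ)
    (S : Finset α) : ∃ T ⊆ S, maxSub m S = m T := by
  obtain ⟨T, hT, h⟩ := Finset.mem_image.1 (Finset.max'_mem (S.powerset.image m)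
    (Finset.Nonempty.image ⟨∅, Finset.empty_mem_powerset S⟩ m))
  exact ⟨T, Finset.mem_powerset.1 hT, h.symm⟩

theorem le_maxSup {α : Type*} [DecidableEq α] {N : Finset α} (m : Finset α → ℝ)
    {S T : Finset α} (hST : S ⊆ T) (hTN : T ⊆ N) : m T ≤ maxSup N m S := by
  refine Finset.le_max' _ _ (Finset.mem_image.2 ⟨T \ S, ?_, ?_⟩)
  · exact Finset.mem_powerset.2 (Finset.sdiff_subset_sdiff hTN subset_rfl)
  · rw [Finset.union_sdiff_of_subset hST]

theorem exists_superset_maxSup_eq {α : Type*} [DecidableEq α] {N : Finset α}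
    (m : Finset α → ℝ) {S : Finset α} (hS : S ⊆ N) :
    ∃ T, S ⊆ T ∧ T ⊆ N ∧ maxSup N m S = m T := by
  obtain ⟨L, hL, h⟩ := Finset.mem_image.1
    (Finset.max'_mem ((N \ S).powerset.image (fun L => m (S ∪ L)))
      (Finset.Nonempty.image ⟨∅, Finset.empty_mem_powerset _⟩ _))
  exact ⟨S ∪ L, Finset.subset_union_left, Finset.union_subset hS
    ((Finset.mem_powerset.1 hL).trans Finset.sdiff_subset), h.symm⟩

/-- The maximum-based monotonizations of a supermodular function are supermodular,
`maxSub m` being non-decreasing and `maxSup N m` being non-increasing. -/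
theorem maximum_based_monotonizations
    {α : Type*} [DecidableEq α] (N : Finset α) (m : Finset α → ℝ)
    (hm : Supermodular N m) :
    (Supermodular N (maxSub m) ∧
      ∀ S T : Finset α, S ⊆ T → T ⊆ N → maxSub m S ≤ maxSub m T) ∧
    (Supermodular N (maxSup N m) ∧
      ∀ S T : Finset α, S ⊆ T → T ⊆ N → maxSup N m T ≤ maxSup N m S) := by
  refine ⟨⟨fun A hA B hB => ?_, fun S T hST _ => ?_⟩, fun A hA B hB => ?_, fun S T hST hT => ?_⟩
  · obtain ⟨A', hA', hmA⟩ := exists_subset_maxSub_eq m A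
    obtain ⟨B', hB', hmB⟩ := exists_subset_maxSub_eq m B
    rw [hmA, hmB]
    exact (hm A' (hA'.trans hA) B' (hB'.trans hB)).trans (add_le_add
      (le_maxSub m (Finset.union_subset_union hA' hB'))
      (le_maxSub m (Finset.inter_subset_inter hA' hB')))
  · obtain ⟨S', hS', hmS⟩ := exists_subset_maxSub_eq m S
    rw [hmS]
    exact le_maxSub m (hS'.trans hST)
  · obtain ⟨A', hA', hAN, hmA⟩ := exists_superset_maxSup_eq m hA
    obtain ⟨B', hB', hBN, hmB⟩ := exists_superset_maxSup_eq m hB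
    rw [hmA, hmB]
    exact (hm A' hAN B' hBN).trans (add_le_add
      (le_maxSup m (Finset.union_subset_union hA' hB') (Finset.union_subset hAN hBN))
      (le_maxSup m (Finset.inter_subset_inter hA' hB') (Finset.inter_subset_left.trans hAN)))
  · obtain ⟨T', hT', hTN, hmT⟩ := exists_superset_maxSup_eq m hT
    rw [hmT]
    exact le_maxSup m (hST.trans hT') hTN
end

section
/- Let N be a finite set and m, r set functions on N belonging to K_ℓ(N). Let g : ℝ → ℝ → ℝ be a function such that for every fixed y ≥ 0 the section x ↦ g(x,y) is non-decreasing and convex on [0,∞), for every fixed x ≥ 0 the section y ↦ g(x,y) is non-decreasing and convex on [0,∞), and g(x′,y) + g(x,y′) ≤ g(x′,y′) + g(x,y) whenever 0 ≤ x ≤ x′ and 0 ≤ y ≤ y′. Then the set function S ↦ g(m(S), r(S)) is supermodular on N. In particular, if h : ℝ → ℝ is non-decreasing and convex on [0,∞) with h(0)=0, then for every m ∈ K_ℓ(N) the composition S ↦ h(m(S)) belongs to K_ℓ(N). -/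
/-- `Kl N m`: `m` is an ℓ-standardized supermodular set function on `N`. -/
def Kl {α : Type*} [DecidableEq α] (N : Finset α) (m : Finset α → ℝ) : Prop :=
  Supermodular N m ∧ m ∅ = 0 ∧ ∀ i ∈ N, m {i} = 0

/-- Adding elements to a set does not decrease an ℓ-standardized supermodular function. -/
theorem Kl.le_union {α : Type*} [DecidableEq α] {N : Finset α} {m : Finset α → ℝ}
    (hm : Kl N m) {A : Finset α} (hA : A ⊆ N) (C : Finset α) (hC : C ⊆ N) :
    m A ≤ m (A ∪ C) := by
  induction C using Finset.induction_on with
  | empty => simp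
  | insert i s _ ih =>
    have hi : i ∈ N := hC (Finset.mem_insert_self i s)
    have hs : s ⊆ N := (Finset.subset_insert i s).trans hC
    have ih := ih hs
    by_cases hiA : i ∈ A ∪ s
    · rwa [Finset.union_insert, Finset.insert_eq_of_mem hiA]
    · have key := hm.1 {i} (Finset.singleton_subset_iff.2 hi) (A ∪ s) (Finset.union_subset hA hs)
      rw [Finset.singleton_inter_of_notMem hiA, hm.2.1, hm.2.2 i hi,
        ← Finset.insert_eq] at key
      rw [Finset.union_insert]
      linarith

theorem Kl.mono {α : Type*} [DecidableEq α] {N : Finset α} {m : Finset α → ℝ}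
    (hm : Kl N m) {A B : Finset α} (hAB : A ⊆ B) (hB : B ⊆ N) : m A ≤ m B := by
  have h := hm.le_union (hAB.trans hB) B hB
  rwa [Finset.union_eq_right.2 hAB] at h

theorem Kl.nonneg {α : Type*} [DecidableEq α] {N : Finset α} {m : Finset α → ℝ}
    (hm : Kl N m) {A : Finset α} (hA : A ⊆ N) : 0 ≤ m A :=
  hm.2.1 ▸ hm.mono (Finset.empty_subset A) hA

/-- A convex function has non-decreasing increments. -/
theorem ConvexOn.add_le_add_of_le {s : Set ℝ} {f : ℝ → ℝ} (hf : ConvexOn ℝ s f)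
    {a b c : ℝ} (ha : a ∈ s) (hd : b + c - a ∈ s) (hab : a ≤ b) (hac : a ≤ c) :
    f b + f c ≤ f (b + c - a) + f a := by
  rcases hab.eq_or_lt with rfl | hab
  · simp [add_comm]
  have hpos : 0 < (b - a) + (c - a) := by linarith
  have hne := hpos.ne'
  set u := (b - a) / ((b - a) + (c - a)) with hu
  set v := (c - a) / ((b - a) + (c - a)) with hv
  have hu0 : 0 ≤ u := div_nonneg (by linarith) hpos.le
  have hv0 : 0 ≤ v := div_nonneg (by linarith) hpos.le
  have huv : u + v = 1 := by rw [hu, hv, ← add_div, div_self hne]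
  have hub : u * ((b - a) + (c - a)) = b - a := div_mul_cancel₀ _ hne
  have hb : v * a + u * (b + c - a) = b := by linear_combination hub + a * huv
  have hc : u * a + v * (b + c - a) = c := by
    linear_combination (b + c - a) * huv - hub
  have h1 := hf.2 ha hd hv0 hu0 (by linarith)
  have h2 := hf.2 ha hd hu0 hv0 huv
  simp only [smul_eq_mul, hb, hc] at h1 h2
  have h3 : (u + v) * (f (b + c - a) + f a) = f (b + c - a) + f a := by rw [huv, one_mul]
  linarith

/-- Composing ℓ-standardized supermodular functions with a function of two variables that is
supermodular, and non-decreasing and convex in each variable, gives a supermodular function. -/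
theorem Kl.supermodular_comp₂ {α : Type*} [DecidableEq α] {N : Finset α} {m r : Finset α → ℝ}
    (hm : Kl N m) (hr : Kl N r) {g : ℝ → ℝ → ℝ}
    (hgx : ∀ y : ℝ, 0 ≤ y →
      MonotoneOn (fun x => g x y) (Set.Ici (0 : ℝ)) ∧
      ConvexOn ℝ (Set.Ici (0 : ℝ)) (fun x => g x y))
    (hgy : ∀ x : ℝ, 0 ≤ x →
      MonotoneOn (fun y => g x y) (Set.Ici (0 : ℝ)) ∧
      ConvexOn ℝ (Set.Ici (0 : ℝ)) (fun y => g x y))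
    (hrect : ∀ x x' y y' : ℝ, 0 ≤ x → x ≤ x' → 0 ≤ y → y ≤ y' →
      g x' y + g x y' ≤ g x' y' + g x y) :
    Supermodular N (fun S => g (m S) (r S)) := by
  intro A hA B hB
  have hI : A ∩ B ⊆ N := Finset.inter_subset_left.trans hA
  have hma := hm.mono (A := A ∩ B) Finset.inter_subset_left hA
  have hmb := hm.mono (A := A ∩ B) Finset.inter_subset_right hB
  have hra := hr.mono (A := A ∩ B) Finset.inter_subset_left hA
  have hrb := hr.mono (A := A ∩ B) Finset.inter_subset_right hB
  have hm0 := hm.nonneg hI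
  have hr0 := hr.nonneg hI
  have hms := hm.1 A hA B hB
  have hrs := hr.1 A hA B hB
  dsimp only
  generalize m (A ∩ B) = a, m A = b, m B = c, m (A ∪ B) = d at *
  generalize r (A ∩ B) = p, r A = q, r B = s, r (A ∪ B) = t at *
  have hd0 : 0 ≤ b + c - a := by linarith
  have ht0 : 0 ≤ q + s - p := by linarith
  have hx : g (b + c - a) (q + s - p) ≤ g d (q + s - p) :=
    (hgx _ ht0).1 hd0 (show 0 ≤ d by linarith) (by linarith)
  have hy : g d (q + s - p) ≤ g d t :=
    (hgy d (by linarith)).1 ht0 (show 0 ≤ t by linarith) (by linarith)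
  have h1 := hrect c (b + c - a) q (q + s - p) (by linarith) (by linarith) (by linarith)
    (by linarith)
  have h2 := hrect a c s (q + s - p) hm0 hmb (by linarith) (by linarith)
  have h3 := (hgx q (by linarith)).2.add_le_add_of_le hm0 hd0 hma hmb
  have h4 := (hgy a hm0).2.add_le_add_of_le hr0 ht0 hra hrb
  linarith

/-- Outer composition with a suitable function `g` of two variables preserves
supermodularity of ℓ-standardized supermodular functions; in particular outer
composition with a non-decreasing convex `h` with `h 0 = 0` maps `K_ℓ(N)` to itself. -/
theorem outer_composition
    {α : Type*} [DecidableEq α] (N : Finset α) (m r : Finset α → ℝ)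
    (hm : Kl N m) (hr : Kl N r) (g : ℝ → ℝ → ℝ)
    (hgx : ∀ y : ℝ, 0 ≤ y →
      MonotoneOn (fun x => g x y) (Set.Ici (0 : ℝ)) ∧
      ConvexOn ℝ (Set.Ici (0 : ℝ)) (fun x => g x y))
    (hgy : ∀ x : ℝ, 0 ≤ x →
      MonotoneOn (fun y => g x y) (Set.Ici (0 : ℝ)) ∧
      ConvexOn ℝ (Set.Ici (0 : ℝ)) (fun y => g x y))
    (hrect : ∀ x x' y y' : ℝ, 0 ≤ x → x ≤ x' → 0 ≤ y → y ≤ y' →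
      g x' y + g x y' ≤ g x' y' + g x y) :
    Supermodular N (fun S => g (m S) (r S)) ∧
    (∀ h : ℝ → ℝ, MonotoneOn h (Set.Ici (0 : ℝ)) → ConvexOn ℝ (Set.Ici (0 : ℝ)) h →
      h 0 = 0 → ∀ m' : Finset α → ℝ, Kl N m' → Kl N (fun S => h (m' S))) := by
  refine ⟨hm.supermodular_comp₂ hr hgx hgy hrect, fun h hmono hconv h0 m' hm' => ⟨?_, ?_, ?_⟩⟩
  · exact hm'.supermodular_comp₂ hm' (g := fun x _ => h x) (fun _ _ => ⟨hmono, hconv⟩)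
      (fun x _ => ⟨monotoneOn_const, convexOn_const (h x) (convex_Ici 0)⟩)
      (fun _ _ _ _ _ _ _ _ => le_rfl)
  · simp only [hm'.2.1, h0]
  · intro i hi
    simp only [hm'.2.2 i hi, h0]
end

section
/- Let N be a finite set and m¹, m² set functions on N belonging to K_ℓ(N). Then their pointwise product m³, defined by m³(S) := m¹(S)·m²(S) for S ⊆ N, also belongs to K_ℓ(N). Analogously, if m¹, m² belong to K_u(N) then m³ belongs to K_u(N). -/
/-- `Ku N m`: `m` is a u-standardized supermodular set function on `N`. -/
def Ku {α : Type*} [DecidableEq α] (N : Finset α) (m : Finset α → ℝ) : Prop :=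
  Supermodular N m ∧ m N = 0 ∧ ∀ i ∈ N, m (N \ {i}) = 0

section

variable {α : Type*} [DecidableEq α] {N : Finset α} {m m₁ m₂ : Finset α → ℝ}

theorem Kl.nonneg_s7 (h : Kl N m) {S : Finset α} (hS : S ⊆ N) : 0 ≤ m S := by
  obtain ⟨hsup, h0, h1⟩ := h
  induction S using Finset.induction_on with
  | empty => exact h0.ge
  | insert i S hi ih =>
    obtain ⟨hiN, hSN⟩ := Finset.insert_subset_iff.1 hS
    have := hsup {i} (Finset.singleton_subset_iff.2 hiN) S hSN
    rw [← Finset.insert_eq, Finset.singleton_inter_of_notMem hi, h0, h1 i hiN] at this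
    linarith [ih hSN]

theorem Kl.mono_s7 (h : Kl N m) {S T : Finset α} (hST : S ⊆ T) (hT : T ⊆ N) : m S ≤ m T := by
  have hD : T \ S ⊆ N := Finset.sdiff_subset.trans hT
  have := h.1 S (hST.trans hT) (T \ S) hD
  rw [Finset.union_sdiff_of_subset hST, Finset.inter_sdiff_self, h.2.1] at this
  linarith [h.nonneg_s7 hD]

theorem Kl.mul (h₁ : Kl N m₁) (h₂ : Kl N m₂) : Kl N (fun S => m₁ S * m₂ S) := by
  refine ⟨fun A hA B hB => ?_, by simp [h₁.2.1], fun i hi => by simp [h₁.2.2 i hi]⟩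
  have hU : A ∪ B ⊆ N := Finset.union_subset hA hB
  have hI : A ∩ B ⊆ N := Finset.inter_subset_left.trans hA
  have hxA₁ := h₁.mono_s7 Finset.inter_subset_left hA (S := A ∩ B)
  have hxB₁ := h₁.mono_s7 Finset.inter_subset_right hB (S := A ∩ B)
  have hxA₂ := h₂.mono_s7 Finset.inter_subset_left hA (S := A ∩ B)
  have hxB₂ := h₂.mono_s7 Finset.inter_subset_right hB (S := A ∩ B)
  have hI₁ := h₁.nonneg_s7 hI
  have hI₂ := h₂.nonneg_s7 hI
  have hprod : (m₁ A + m₁ B - m₁ (A ∩ B)) * (m₂ A + m₂ B - m₂ (A ∩ B)) ≤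
      m₁ (A ∪ B) * m₂ (A ∪ B) :=
    mul_le_mul (by linarith [h₁.1 A hA B hB]) (by linarith [h₂.1 A hA B hB])
      (by linarith) (h₁.nonneg_s7 hU)
  have hAB := mul_nonneg (sub_nonneg.2 hxA₁) (sub_nonneg.2 hxB₂)
  have hBA := mul_nonneg (sub_nonneg.2 hxB₁) (sub_nonneg.2 hxA₂)
  dsimp only
  linarith

theorem Supermodular.compl (h : Supermodular N m) : Supermodular N (fun S => m (N \ S)) := by
  intro A _ B _
  have := h (N \ A) Finset.sdiff_subset (N \ B) Finset.sdiff_subset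
  rw [← Finset.sdiff_inter_distrib_right, ← Finset.sdiff_union_distrib] at this
  dsimp only
  linarith

theorem Ku.compl (h : Ku N m) : Kl N (fun S => m (N \ S)) :=
  ⟨h.1.compl, by simpa using h.2.1, h.2.2⟩

theorem Supermodular.congr (h : Supermodular N m₁) (heq : ∀ S ⊆ N, m₁ S = m₂ S) :
    Supermodular N m₂ := by
  intro A hA B hB
  rw [← heq A hA, ← heq B hB, ← heq _ (Finset.union_subset hA hB),
    ← heq _ (Finset.inter_subset_left.trans hA)]
  exact h A hA B hB

theorem Ku.mul (h₁ : Ku N m₁) (h₂ : Ku N m₂) : Ku N (fun S => m₁ S * m₂ S) := by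
  refine ⟨(h₁.compl.mul h₂.compl).1.compl.congr fun S hS => ?_, by simp [h₁.2.1],
    fun i hi => by simp [h₁.2.2 i hi]⟩
  simp only [Finset.sdiff_sdiff_eq_self hS]

end

/-- Pointwise multiplication preserves `K_ℓ(N)`, and analogously `K_u(N)`. -/
theorem pointwise_product
    {α : Type*} [DecidableEq α] (N : Finset α) (m₁ m₂ : Finset α → ℝ) :
    (Kl N m₁ → Kl N m₂ → Kl N (fun S => m₁ S * m₂ S)) ∧
    (Ku N m₁ → Ku N m₂ → Ku N (fun S => m₁ S * m₂ S)) := by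
  exact ⟨Kl.mul, Ku.mul⟩
end

section
/- Let N be a finite set and m¹, m² supermodular set functions on N that are qualitatively equivalent, i.e. for every elementary triplet (a,b|C) one has Δm¹(a,b|C) = 0 if and only if Δm²(a,b|C) = 0. For a set function m let m_ℓ denote its ℓ-standardization, m_ℓ(T) := m(T) − m(∅) + Σ_{i∈T}(m(∅) − m({i})). Then for every M ⊆ N: (m¹_ℓ(S) = m¹_ℓ(S∩M) for all S ⊆ N) if and only if (m²_ℓ(S) = m²_ℓ(S∩M) for all S ⊆ N); in particular the least such set M (the support of m¹) coincides with the least such set for m² (the support of m²). -/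
/-- `Δ m a b C = m (C ∪ {a,b}) + m C - m (C ∪ {a}) - m (C ∪ {b})`,
the supermodularity difference for the elementary triplet `(a,b|C)`. -/
def Δ {α : Type*} [DecidableEq α] (m : Finset α → ℝ) (a b : α) (C : Finset α) : ℝ :=
  m (C ∪ {a, b}) + m C - m (C ∪ {a}) - m (C ∪ {b})

/-- The ℓ-standardization of `m`: `m_ℓ(T) = m T - m ∅ + Σ_{i∈T} (m ∅ - m {i})`. -/
def lstan {α : Type*} [DecidableEq α] (m : Finset α → ℝ) (T : Finset α) : ℝ :=
  m T - m ∅ + ∑ i ∈ T, (m ∅ - m {i})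

/-- The supermodularity difference is invariant under ℓ-standardization. -/
theorem Δ_lstan {α : Type*} [DecidableEq α] (m : Finset α → ℝ) {a b : α} {C : Finset α}
    (hab : a ≠ b) (ha : a ∉ C) (hb : b ∉ C) : Δ (lstan m) a b C = Δ m a b C := by
  have hab' : C ∪ {a, b} = insert a (insert b C) := by grind
  have ha' : C ∪ {a} = insert a C := by grind
  have hb' : C ∪ {b} = insert b C := by grind
  have hins : a ∉ insert b C := by grind
  simp only [Δ, lstan, hab', ha', hb', Finset.sum_insert hins, Finset.sum_insert ha,
    Finset.sum_insert hb]
  ring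

/-- Adding `a` does not change the ℓ-standardization when all differences at `a` vanish. -/
theorem lstan_insert_of_Δ_eq_zero {α : Type*} [DecidableEq α] {N : Finset α}
    {m : Finset α → ℝ} {a : α}
    (h : ∀ b ∈ N, a ≠ b → ∀ C ⊆ N \ {a, b}, Δ m a b C = 0)
    (C : Finset α) (hC : C ⊆ N) : lstan m (insert a C) = lstan m C := by
  by_cases ha : a ∈ C
  · rw [Finset.insert_eq_of_mem ha]
  induction C using Finset.induction_on with
  | empty => simp [lstan]
  | insert b C hb ih =>
    have hab : a ≠ b := by grind
    have haC : a ∉ C := by grind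
    have key := h b (by grind) hab C (by grind)
    rw [← Δ_lstan m hab haC hb, Δ] at key
    have hab' : C ∪ {a, b} = insert a (insert b C) := by grind
    have ha' : C ∪ {a} = insert a C := by grind
    have hb' : C ∪ {b} = insert b C := by grind
    rw [hab', ha', hb'] at key
    linarith [ih (by grind) haC]

/-- The ℓ-standardization is a lifting from `M` iff all supermodularity differences
involving an element outside `M` vanish. -/
theorem lstan_eq_inter_iff {α : Type*} [DecidableEq α] (N M : Finset α) (m : Finset α → ℝ) :
    (∀ S ⊆ N, lstan m S = lstan m (S ∩ M)) ↔
      ∀ a ∈ N, a ∉ M → ∀ b ∈ N, a ≠ b → ∀ C ⊆ N \ {a, b}, Δ m a b C = 0 := by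
  constructor
  · intro h a haN haM b hbN hab C hC
    rw [← Δ_lstan m hab (by grind) (by grind), Δ,
      h (C ∪ {a, b}) (by grind), h C (by grind), h (C ∪ {a}) (by grind), h (C ∪ {b}) (by grind)]
    have h₁ : (C ∪ {a, b}) ∩ M = (C ∪ {b}) ∩ M := by grind
    have h₂ : (C ∪ {a}) ∩ M = C ∩ M := by grind
    rw [h₁, h₂]
    ring
  · intro h S hS
    have lift : ∀ T ⊆ S \ M, lstan m ((S ∩ M) ∪ T) = lstan m (S ∩ M) := by
      intro T
      induction T using Finset.induction_on with
      | empty => simp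
      | insert a T _ ih =>
        intro hT
        rw [Finset.union_insert,
          lstan_insert_of_Δ_eq_zero (h a (by grind) (by grind)) _ (by grind), ih (by grind)]
    have hSM : (S ∩ M) ∪ (S \ M) = S := by grind
    simpa only [hSM] using lift (S \ M) subset_rfl

/-- Qualitatively equivalent supermodular functions have the same support:
for each `M ⊆ N`, the ℓ-standardization of `m¹` is a lifting from `M`
iff that of `m²` is; hence the least such `M` coincides for `m¹` and `m²`. -/
theorem qualitative_equivalence_same_support
    {α : Type*} [DecidableEq α] (N : Finset α) (m₁ m₂ : Finset α → ℝ)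
    (h₁ : Supermodular N m₁) (h₂ : Supermodular N m₂)
    (heq : ∀ a ∈ N, ∀ b ∈ N, a ≠ b → ∀ C ⊆ N \ {a, b},
      (Δ m₁ a b C = 0 ↔ Δ m₂ a b C = 0)) :
    ∀ M ⊆ N,
      ((∀ S ⊆ N, lstan m₁ S = lstan m₁ (S ∩ M)) ↔
        (∀ S ⊆ N, lstan m₂ S = lstan m₂ (S ∩ M))) := by
  intro M _
  rw [lstan_eq_inter_iff, lstan_eq_inter_iff]
  exact forall₂_congr fun a ha => forall_congr' fun _ => forall₂_congr fun b hb =>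
    forall_congr' fun hab => forall₂_congr fun C hC => heq a ha b hb hab C hC
end

section
/- Let N be a finite set, M ⊆ N, and m a supermodular set function on N. Define the max-minor r(S) := max{ m(S∪L) : L ⊆ N∖M } for S ⊆ M. Then r is a supermodular set function on M. -/
/-- The max-minor of `m` for `M`: `r S = max { m (S ∪ L) : L ⊆ N ∖ M }`. -/
noncomputable def maxMinor {α : Type*} [DecidableEq α] (N M : Finset α)
    (m : Finset α → ℝ) (S : Finset α) : ℝ :=
  ((N \ M).powerset.image (fun L => m (S ∪ L))).max'
    (Finset.Nonempty.image ⟨∅, Finset.empty_mem_powerset _⟩ _)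

theorem le_maxMinor {α : Type*} [DecidableEq α] {N M L : Finset α} (m : Finset α → ℝ)
    (S : Finset α) (hL : L ⊆ N \ M) : m (S ∪ L) ≤ maxMinor N M m S :=
  Finset.le_max' _ _ (Finset.mem_image_of_mem (fun L => m (S ∪ L)) (Finset.mem_powerset.2 hL))

theorem exists_maxMinor_eq {α : Type*} [DecidableEq α] (N M : Finset α) (m : Finset α → ℝ)
    (S : Finset α) : ∃ L ⊆ N \ M, m (S ∪ L) = maxMinor N M m S := by
  obtain ⟨L, hL, h⟩ := Finset.mem_image.1 (Finset.max'_mem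
    ((N \ M).powerset.image (fun L => m (S ∪ L)))
    (Finset.Nonempty.image ⟨∅, Finset.empty_mem_powerset _⟩ _))
  exact ⟨L, Finset.mem_powerset.1 hL, h⟩

/-- The max-minor projection of a supermodular function is supermodular. -/
theorem maxMinor_supermodular
    {α : Type*} [DecidableEq α] (N M : Finset α) (hMN : M ⊆ N)
    (m : Finset α → ℝ) (hm : Supermodular N m) :
    Supermodular M (maxMinor N M m) := by
  intro A hA B hB
  obtain ⟨K, hK, hAK⟩ := exists_maxMinor_eq N M m A
  obtain ⟨L, hL, hBL⟩ := exists_maxMinor_eq N M m B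
  rw [← hAK, ← hBL]
  have union_eq : (A ∪ K) ∪ (B ∪ L) = (A ∪ B) ∪ (K ∪ L) := Finset.union_union_union_comm ..
  have inter_eq : (A ∪ K) ∩ (B ∪ L) = (A ∩ B) ∪ (K ∩ L) := by
    ext x
    have hxA := @hA x
    have hxB := @hB x
    have hxK := @hK x
    have hxL := @hL x
    simp only [Finset.mem_sdiff] at hxK hxL
    simp only [Finset.mem_union, Finset.mem_inter]
    tauto
  calc m (A ∪ K) + m (B ∪ L)
      ≤ m ((A ∪ K) ∪ (B ∪ L)) + m ((A ∪ K) ∩ (B ∪ L)) :=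
        hm _ (Finset.union_subset (hA.trans hMN) (hK.trans Finset.sdiff_subset))
          _ (Finset.union_subset (hB.trans hMN) (hL.trans Finset.sdiff_subset))
    _ = m ((A ∪ B) ∪ (K ∪ L)) + m ((A ∩ B) ∪ (K ∩ L)) := by rw [union_eq, inter_eq]
    _ ≤ maxMinor N M m (A ∪ B) + maxMinor N M m (A ∩ B) :=
        add_le_add (le_maxMinor m _ (Finset.union_subset hK hL))
          (le_maxMinor m _ (Finset.inter_subset_left.trans hK))
end

section
/- Let the finite set N be partitioned into non-empty disjoint sets R and L. If r belongs to K_↑(R) and l belongs to K_↑(L), then the set function m on N defined by m(S) := r(S∩R)·l(S∩L) for S ⊆ N belongs to K_↑(N). Conversely, if m is a non-zero function in K_↑(N) and m(S) = r(S∩R)·l(S∩L) for all S ⊆ N, where r is a non-negative set function on R and l is a non-negative set function on L, then r belongs to K_↑(R) and l belongs to K_↑(L). -/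
/-- `Kup N m`: `m` is a non-negative, non-decreasing, supermodular set function on `N`. -/
def Kup {α : Type*} [DecidableEq α] (N : Finset α) (m : Finset α → ℝ) : Prop :=
  (∀ S ⊆ N, 0 ≤ m S) ∧ (∀ S T : Finset α, S ⊆ T → T ⊆ N → m S ≤ m T) ∧
  Supermodular N m

theorem mul_add_mul_le_of_supermodular {a b u i a' b' u' i' : ℝ} (hi : 0 ≤ i) (hi' : 0 ≤ i')
    (hia : i ≤ a) (hib : i ≤ b) (h : a + b ≤ u + i)
    (hia' : i' ≤ a') (hib' : i' ≤ b') (h' : a' + b' ≤ u' + i') :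
    a * a' + b * b' ≤ u * u' + i * i' := by
  have hu : (a + b - i) * (a' + b' - i') ≤ u * u' :=
    mul_le_mul (by linarith) (by linarith) (by linarith) (by linarith)
  nlinarith [mul_nonneg (sub_nonneg.2 hia) (sub_nonneg.2 hib'),
    mul_nonneg (sub_nonneg.2 hib) (sub_nonneg.2 hia')]

theorem Kup.mul {α : Type*} [DecidableEq α] {R L : Finset α} {r l : Finset α → ℝ}
    (hr : Kup R r) (hl : Kup L l) (N : Finset α) :
    Kup N (fun S => r (S ∩ R) * l (S ∩ L)) := by
  obtain ⟨hr0, hrm, hrs⟩ := hr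
  obtain ⟨hl0, hlm, hls⟩ := hl
  have hsub (S U : Finset α) : S ∩ U ⊆ U := Finset.inter_subset_right
  refine ⟨fun S _ => mul_nonneg (hr0 _ (hsub S R)) (hl0 _ (hsub S L)), fun S T hST _ => ?_,
    fun A _ B _ => ?_⟩
  · exact mul_le_mul (hrm _ _ (Finset.inter_subset_inter_right hST) (hsub T R))
      (hlm _ _ (Finset.inter_subset_inter_right hST) (hsub T L))
      (hl0 _ (hsub S L)) (hr0 _ (hsub T R))
  · have hA : A ∩ B ⊆ A := Finset.inter_subset_left
    have hB : A ∩ B ⊆ B := Finset.inter_subset_right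
    have hrs' := hrs _ (hsub A R) _ (hsub B R)
    have hls' := hls _ (hsub A L) _ (hsub B L)
    rw [← Finset.union_inter_distrib_right, ← Finset.inter_inter_distrib_right] at hrs' hls'
    exact mul_add_mul_le_of_supermodular (hr0 _ (hsub _ R)) (hl0 _ (hsub _ L))
      (hrm _ _ (Finset.inter_subset_inter_right hA) (hsub _ R))
      (hrm _ _ (Finset.inter_subset_inter_right hB) (hsub _ R)) hrs'
      (hlm _ _ (Finset.inter_subset_inter_right hA) (hsub _ L))
      (hlm _ _ (Finset.inter_subset_inter_right hB) (hsub _ L)) hls'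

theorem Kup.left_of_mul {α : Type*} [DecidableEq α] {R L T : Finset α} {r l : Finset α → ℝ}
    (hdisj : Disjoint R L) (h : Kup (R ∪ L) (fun S => r (S ∩ R) * l (S ∩ L)))
    (hr : ∀ S ⊆ R, 0 ≤ r S) (hT : T ⊆ L) (hlT : 0 < l T) : Kup R r := by
  obtain ⟨-, hm, hs⟩ := h
  have hTR : T ∩ R = ∅ := Finset.disjoint_iff_inter_eq_empty.1 (hdisj.symm.mono_left hT)
  have eqR {A : Finset α} (hA : A ⊆ R) : (A ∪ T) ∩ R = A := by
    rw [Finset.union_inter_distrib_right, hTR, Finset.union_empty, Finset.inter_eq_left.2 hA]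
  have eqL {A : Finset α} (hA : A ⊆ R) : (A ∪ T) ∩ L = T := by
    rw [Finset.union_inter_distrib_right, Finset.inter_eq_left.2 hT,
      Finset.disjoint_iff_inter_eq_empty.1 (hdisj.mono_left hA), Finset.empty_union]
  refine ⟨hr, fun A B hAB hB => ?_, fun A hA B hB => ?_⟩
  · have := hm (A ∪ T) (B ∪ T) (Finset.union_subset_union_left hAB) (Finset.union_subset_union hB hT)
    simp only [eqR hB, eqL hB, eqR (hAB.trans hB), eqL (hAB.trans hB)] at this
    exact le_of_mul_le_mul_right this hlT
  · have := hs (A ∪ T) (Finset.union_subset_union hA hT) (B ∪ T) (Finset.union_subset_union hB hT)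
    have hU : A ∪ B ⊆ R := Finset.union_subset hA hB
    have hI : A ∩ B ⊆ R := Finset.inter_subset_left.trans hA
    rw [← Finset.union_union_distrib_right, ← Finset.inter_union_distrib_right] at this
    simp only [eqR hA, eqL hA, eqR hB, eqL hB, eqR hU, eqL hU, eqR hI, eqL hI, ← add_mul] at this
    exact le_of_mul_le_mul_right this hlT

/-- Product-based composition: if `r ∈ K_↑(R)` and `l ∈ K_↑(L)` then
`S ↦ r (S∩R) · l (S∩L)` is in `K_↑(N)`; conversely, if this product function is a
non-zero member of `K_↑(N)` with `r, l` non-negative, then `r ∈ K_↑(R)` and `l ∈ K_↑(L)`. -/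
theorem product_composition
    {α : Type*} [DecidableEq α] (N R L : Finset α)
    (hR : R.Nonempty) (hL : L.Nonempty) (hdisj : Disjoint R L) (hunion : R ∪ L = N)
    (r l : Finset α → ℝ) :
    (Kup R r → Kup L l → Kup N (fun S => r (S ∩ R) * l (S ∩ L))) ∧
    (Kup N (fun S => r (S ∩ R) * l (S ∩ L)) →
      (∃ S ⊆ N, r (S ∩ R) * l (S ∩ L) ≠ 0) →
      (∀ S ⊆ R, 0 ≤ r S) → (∀ S ⊆ L, 0 ≤ l S) →
      Kup R r ∧ Kup L l) := by
  subst hunion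
  refine ⟨fun hr hl => hr.mul hl _, fun h ⟨S, _, hS⟩ hr hl => ?_⟩
  have hSR : S ∩ R ⊆ R := Finset.inter_subset_right
  have hSL : S ∩ L ⊆ L := Finset.inter_subset_right
  refine ⟨h.left_of_mul hdisj hr hSL ((hl _ hSL).lt_of_ne' (right_ne_zero_of_mul hS)), ?_⟩
  have h' : Kup (L ∪ R) (fun S => l (S ∩ L) * r (S ∩ R)) := by
    simpa only [Finset.union_comm L R, mul_comm] using h
  exact h'.left_of_mul hdisj.symm hl hSR ((hr _ hSR).lt_of_ne' (left_ne_zero_of_mul hS))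
end

section
/- Let the finite set N be partitioned into non-empty disjoint sets R and L, let r belong to K_↑(R) and l belong to K_↑(L), and let m be the set function on N defined by m(S) := r(S∩R)·l(S∩L) for S ⊆ N. Then m generates an extreme ray of the cone K_↑(N) if and only if r generates an extreme ray of K_↑(R) and l generates an extreme ray of K_↑(L). -/
/-- `m` generates an extreme ray of the cone `{m | C m}` of set functions on `N`. -/
def ExtremeRay {α : Type*} (N : Finset α) (C : (Finset α → ℝ) → Prop)
    (m : Finset α → ℝ) : Prop :=
  C m ∧ (∃ S ⊆ N, m S ≠ 0) ∧
  ∀ m₁ m₂ : Finset α → ℝ, C m₁ → C m₂ → (∀ S ⊆ N, m S = m₁ S + m₂ S) →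
    ∃ a b : ℝ, 0 ≤ a ∧ 0 ≤ b ∧ (∀ S ⊆ N, m₁ S = a * m S) ∧ (∀ S ⊆ N, m₂ S = b * m S)

section KupLemmas

variable {α : Type*} [DecidableEq α] {N R L : Finset α} {r l m m₁ m₂ : Finset α → ℝ}

theorem Kup.const_mul (hm : Kup N m) {c : ℝ} (hc : 0 ≤ c) : Kup N (fun S => c * m S) := by
  obtain ⟨h0, hmono, hsup⟩ := hm
  refine ⟨fun S hS => mul_nonneg hc (h0 S hS),
    fun S T hST hT => mul_le_mul_of_nonneg_left (hmono S T hST hT) hc, fun A hA B hB => ?_⟩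
  have h := mul_le_mul_of_nonneg_left (hsup A hA B hB) hc
  linarith

/-- A function of `K_↑(R)` that does not vanish identically is positive at `R`. -/
theorem Kup.pos_of_ne_zero (hr : Kup R r) (hne : ∃ S ⊆ R, r S ≠ 0) : 0 < r R := by
  obtain ⟨S, hS, hne⟩ := hne
  exact ((hr.1 S hS).lt_of_ne' hne).trans_le (hr.2.1 S R hS subset_rfl)

theorem Kup.mul_inter (hr : Kup R r) (hl : Kup L l) :
    Kup N (fun S => r (S ∩ R) * l (S ∩ L)) := by
  have hsub : ∀ S X : Finset α, S ∩ X ⊆ X := fun _ _ => Finset.inter_subset_right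
  refine ⟨fun S _ => mul_nonneg (hr.1 _ (hsub _ _)) (hl.1 _ (hsub _ _)),
    fun S T hST _ => ?_, fun A _ B _ => ?_⟩
  · exact mul_le_mul (hr.2.1 _ _ (Finset.inter_subset_inter_right hST) (hsub _ _))
      (hl.2.1 _ _ (Finset.inter_subset_inter_right hST) (hsub _ _))
      (hl.1 _ (hsub _ _)) (hr.1 _ (hsub _ _))
  · simp only [Finset.union_inter_distrib_right]
    rw [Finset.inter_inter_distrib_right A B R, Finset.inter_inter_distrib_right A B L]
    have key : ∀ (X : Finset α) (f : Finset α → ℝ), Kup X f →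
        0 ≤ f (A ∩ X ∩ (B ∩ X)) ∧ f (A ∩ X ∩ (B ∩ X)) ≤ f (A ∩ X) ∧
        f (A ∩ X ∩ (B ∩ X)) ≤ f (B ∩ X) ∧
        f (A ∩ X) + f (B ∩ X) ≤ f (A ∩ X ∪ B ∩ X) + f (A ∩ X ∩ (B ∩ X)) := fun X f hf =>
      ⟨hf.1 _ (Finset.inter_subset_left.trans (hsub _ _)),
        hf.2.1 _ _ Finset.inter_subset_left (hsub _ _),
        hf.2.1 _ _ Finset.inter_subset_right (hsub _ _), hf.2.2 _ (hsub _ _) _ (hsub _ _)⟩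
    obtain ⟨hi, hia, hib, hu⟩ := key R r hr
    obtain ⟨hj, hjc, hjd, hv⟩ := key L l hl
    generalize r (A ∩ R ∩ (B ∩ R)) = i at *
    generalize l (A ∩ L ∩ (B ∩ L)) = j at *
    generalize r (A ∩ R ∪ B ∩ R) = u at *
    generalize l (A ∩ L ∪ B ∩ L) = v at *
    generalize r (A ∩ R) = a at *
    generalize r (B ∩ R) = b at *
    generalize l (A ∩ L) = c at *
    generalize l (B ∩ L) = d at *
    have huv : (a + b - i) * (c + d - j) ≤ u * v :=
      mul_le_mul (by linarith) (by linarith) (by linarith) (by linarith)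
    nlinarith [mul_nonneg (sub_nonneg.2 hia) (sub_nonneg.2 hjd),
      mul_nonneg (sub_nonneg.2 hib) (sub_nonneg.2 hjc)]

theorem Kup.union_right (hm : Kup N m) (hR : R ⊆ N) {T : Finset α} (hT : T ⊆ N) :
    Kup R (fun S => m (S ∪ T)) := by
  have hsub : ∀ S ⊆ R, S ∪ T ⊆ N := fun S hS => Finset.union_subset (hS.trans hR) hT
  refine ⟨fun S hS => hm.1 _ (hsub S hS),
    fun S S' hSS' hS' => hm.2.1 _ _ (Finset.union_subset_union_left hSS') (hsub S' hS'),
    fun A hA B hB => ?_⟩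
  have h := hm.2.2 _ (hsub A hA) _ (hsub B hB)
  rwa [← Finset.union_union_distrib_right, ← Finset.inter_union_distrib_right] at h

theorem ExtremeRay.eq_const_mul_of_const_mul_eq_add (hr : ExtremeRay R (Kup R) r) {c : ℝ}
    (hc : 0 ≤ c) (h₁ : Kup R m₁) (h₂ : Kup R m₂) (h : ∀ S ⊆ R, c * r S = m₁ S + m₂ S) :
    ∃ a : ℝ, ∀ S ⊆ R, m₁ S = a * r S := by
  rcases hc.eq_or_lt with rfl | hpos
  · refine ⟨0, fun S hS => ?_⟩
    linarith [h S hS, h₁.1 S hS, h₂.1 S hS]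
  · obtain ⟨a, -, -, -, ha, -⟩ := hr.2.2 _ _ (h₁.const_mul (inv_nonneg.2 hc))
      (h₂.const_mul (inv_nonneg.2 hc)) fun S hS => by
        rw [← mul_add, ← h S hS, inv_mul_cancel_left₀ hpos.ne']
    refine ⟨c * a, fun S hS => ?_⟩
    rw [mul_assoc, ← ha S hS, mul_inv_cancel_left₀ hpos.ne']

/-- A summand of the product of two extreme functions is a multiple of that product. -/
theorem ExtremeRay.summand_eq_const_mul (hdisj : Disjoint R L) (hunion : R ∪ L = N)
    (hr : ExtremeRay R (Kup R) r) (hl : ExtremeRay L (Kup L) l)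
    (h₁ : Kup N m₁) (h₂ : Kup N m₂)
    (h : ∀ S ⊆ N, r (S ∩ R) * l (S ∩ L) = m₁ S + m₂ S) :
    ∃ a : ℝ, 0 ≤ a ∧ ∀ S ⊆ N, m₁ S = a * (r (S ∩ R) * l (S ∩ L)) := by
  have hRN : R ⊆ N := hunion ▸ Finset.subset_union_left
  have hLN : L ⊆ N := hunion ▸ Finset.subset_union_right
  have hsum : ∀ S ⊆ R, ∀ T ⊆ L, r S * l T = m₁ (S ∪ T) + m₂ (S ∪ T) := fun S hS T hT => by
    rw [← h _ (Finset.union_subset (hS.trans hRN) (hT.trans hLN)),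
      Finset.union_inter_distrib_right, Finset.union_inter_distrib_right,
      Finset.inter_eq_left.2 hS, Finset.inter_eq_left.2 hT,
      Finset.disjoint_iff_inter_eq_empty.1 (hdisj.symm.mono_left hT),
      Finset.disjoint_iff_inter_eq_empty.1 (hdisj.mono_left hS), Finset.union_empty,
      Finset.empty_union]
  have hrR := hr.1.pos_of_ne_zero hr.2.1
  have hlL := hl.1.pos_of_ne_zero hl.2.1
  obtain ⟨b, hb⟩ := hl.eq_const_mul_of_const_mul_eq_add hrR.le
    (h₁.union_right hLN hRN) (h₂.union_right hLN hRN) fun T hT => by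
      rw [hsum R subset_rfl T hT, Finset.union_comm]
  have hb0 : 0 ≤ b :=
    nonneg_of_mul_nonneg_left ((h₁.1 _ (Finset.union_subset hLN hRN)).trans_eq (hb L subset_rfl))
      hlL
  refine ⟨b / r R, div_nonneg hb0 hrR.le, fun S hS => ?_⟩
  have hSL : S ∩ L ⊆ L := Finset.inter_subset_right
  have hSR : S ∩ R ⊆ R := Finset.inter_subset_right
  obtain ⟨a, ha⟩ := hr.eq_const_mul_of_const_mul_eq_add (hl.1.1 _ hSL)
    (h₁.union_right hRN (hSL.trans hLN)) (h₂.union_right hRN (hSL.trans hLN)) fun X hX => by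
      rw [← hsum X hX _ hSL, mul_comm]
  have haR : m₁ (R ∪ S ∩ L) = a * r R := ha R subset_rfl
  have haS : m₁ (S ∩ R ∪ S ∩ L) = a * r (S ∩ R) := ha _ hSR
  have hbS : m₁ (S ∩ L ∪ R) = b * l (S ∩ L) := hb _ hSL
  rw [Finset.union_comm, haR] at hbS
  rw [← Finset.inter_union_distrib_left, hunion, Finset.inter_eq_left.2 hS] at haS
  rw [haS]
  field_simp
  linear_combination r (S ∩ R) * hbS

theorem ExtremeRay.mul_inter (hdisj : Disjoint R L) (hunion : R ∪ L = N)
    (hr : ExtremeRay R (Kup R) r) (hl : ExtremeRay L (Kup L) l) :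
    ExtremeRay N (Kup N) (fun S => r (S ∩ R) * l (S ∩ L)) := by
  refine ⟨hr.1.mul_inter hl.1, ⟨N, subset_rfl, ?_⟩, fun m₁ m₂ h₁ h₂ h => ?_⟩
  · have hRN : R ⊆ N := hunion ▸ Finset.subset_union_left
    have hLN : L ⊆ N := hunion ▸ Finset.subset_union_right
    simp only [Finset.inter_eq_right.2 hRN, Finset.inter_eq_right.2 hLN]
    exact (mul_pos (hr.1.pos_of_ne_zero hr.2.1) (hl.1.pos_of_ne_zero hl.2.1)).ne'
  · obtain ⟨a, ha0, ha⟩ := hr.summand_eq_const_mul hdisj hunion hl h₁ h₂ h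
    obtain ⟨b, hb0, hb⟩ := hr.summand_eq_const_mul hdisj hunion hl h₂ h₁ fun S hS =>
      (h S hS).trans (add_comm _ _)
    exact ⟨a, b, ha0, hb0, ha, hb⟩

theorem ExtremeRay.of_mul_inter_left (hdisj : Disjoint R L) (hunion : R ∪ L = N)
    (hr : Kup R r) (hl : Kup L l)
    (hm : ExtremeRay N (Kup N) (fun S => r (S ∩ R) * l (S ∩ L))) :
    ExtremeRay R (Kup R) r := by
  obtain ⟨-, ⟨S₀, -, hne⟩, hext⟩ := hm
  have hlL : 0 < l L :=
    hl.pos_of_ne_zero ⟨S₀ ∩ L, Finset.inter_subset_right, right_ne_zero_of_mul hne⟩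
  refine ⟨hr, ⟨S₀ ∩ R, Finset.inter_subset_right, left_ne_zero_of_mul hne⟩,
    fun r₁ r₂ h₁ h₂ h => ?_⟩
  obtain ⟨a, b, ha0, hb0, ha, hb⟩ := hext _ _ (h₁.mul_inter hl) (h₂.mul_inter hl) fun S _ => by
    simp only [h _ Finset.inter_subset_right, add_mul]
  have hcancel : ∀ (f : Finset α → ℝ) (c : ℝ),
      (∀ S ⊆ N, f (S ∩ R) * l (S ∩ L) = c * (r (S ∩ R) * l (S ∩ L))) →
      ∀ S ⊆ R, f S = c * r S := fun f c hf S hS => by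
    have hSR : (S ∪ L) ∩ R = S := by
      rw [Finset.union_inter_distrib_right, Finset.inter_eq_left.2 hS,
        Finset.disjoint_iff_inter_eq_empty.1 hdisj.symm, Finset.union_empty]
    have hSL : (S ∪ L) ∩ L = L := Finset.inter_eq_right.2 Finset.subset_union_right
    have h := hf (S ∪ L) (hunion ▸ Finset.union_subset_union_left hS)
    rw [hSR, hSL, ← mul_assoc] at h
    exact mul_right_cancel₀ hlL.ne' h
  exact ⟨a, b, ha0, hb0, hcancel r₁ a ha, hcancel r₂ b hb⟩

end KupLemmas

/-- The product `S ↦ r (S∩R) · l (S∩L)` generates an extreme ray of `K_↑(N)` iff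
`r` generates an extreme ray of `K_↑(R)` and `l` generates an extreme ray of `K_↑(L)`. -/
theorem product_composition_extremality
    {α : Type*} [DecidableEq α] (N R L : Finset α)
    (hR : R.Nonempty) (hL : L.Nonempty) (hdisj : Disjoint R L) (hunion : R ∪ L = N)
    (r l : Finset α → ℝ) (hr : Kup R r) (hl : Kup L l) :
    ExtremeRay N (Kup N) (fun S => r (S ∩ R) * l (S ∩ L)) ↔
      ExtremeRay R (Kup R) r ∧ ExtremeRay L (Kup L) l := by
  refine ⟨fun hm => ⟨hm.of_mul_inter_left hdisj hunion hr hl, ?_⟩,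
    fun h => h.1.mul_inter hdisj hunion h.2⟩
  simp only [mul_comm (r _)] at hm
  exact hm.of_mul_inter_left hdisj.symm ((Finset.union_comm L R).trans hunion) hl hr
end

section
/- Let N be a finite set with |N| ≥ 2, x ∈ N, and M := N∖{x}. Given a set function r on M, define its lower modular extension m on N by: m(S) := r(S∩M) if x ∈ S, and m(S) := r(∅) + Σ_{i∈S}(r({i}) − r(∅)) if x ∉ S (i.e. the value of the modular part r − r_ℓ of r at S, where r_ℓ(T) := r(T) − r(∅) + Σ_{i∈T}(r(∅) − r({i})) is the ℓ-standardization of r). Then m is supermodular on N if and only if r is supermodular on M. -/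
/-- A supermodular function grows at least as fast as its modular part
when a disjoint set is added. -/
theorem Supermodular.add_sum_le {α : Type*} [DecidableEq α] {M : Finset α}
    {r : Finset α → ℝ} (hr : Supermodular M r) {A D : Finset α} (hA : A ⊆ M) (hD : D ⊆ M)
    (hAD : Disjoint A D) : r A + ∑ i ∈ D, (r {i} - r ∅) ≤ r (A ∪ D) := by
  induction D using Finset.induction_on with
  | empty => simp
  | insert i D hi ih =>
    rw [Finset.disjoint_insert_right] at hAD
    rw [Finset.insert_subset_iff] at hD
    have hstep := hr (A ∪ D) (Finset.union_subset hA hD.2) {i}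
      (Finset.singleton_subset_iff.2 hD.1)
    have hinter : (A ∪ D) ∩ {i} = ∅ := by
      rw [Finset.inter_singleton_of_notMem]
      simp [hAD.1, hi]
    have hunion : A ∪ D ∪ {i} = A ∪ insert i D := by
      ext j; simp
    rw [hinter, hunion] at hstep
    rw [Finset.sum_insert hi]
    linarith [ih hD.2 hAD.2]

/-- The supermodular inequality for the lower modular extension when exactly one of the
two sets contains the added element. -/
theorem Supermodular.add_modular_le {α : Type*} [DecidableEq α] {M : Finset α}
    {r : Finset α → ℝ} (hr : Supermodular M r) {A B : Finset α} (hB : B ⊆ M) :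
    r (A ∩ M) + (r ∅ + ∑ i ∈ B, (r {i} - r ∅)) ≤
      r ((A ∪ B) ∩ M) + (r ∅ + ∑ i ∈ A ∩ B, (r {i} - r ∅)) := by
  have h := hr.add_sum_le (A := A ∩ M) (D := B \ A) Finset.inter_subset_right
    (Finset.sdiff_subset.trans hB)
    (Finset.disjoint_sdiff.mono_left Finset.inter_subset_left)
  have hunion : A ∩ M ∪ B \ A = (A ∪ B) ∩ M := by
    ext j
    have := @hB j
    simp only [Finset.mem_union, Finset.mem_inter, Finset.mem_sdiff]
    tauto
  rw [hunion] at h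
  have hsum := Finset.sum_inter_add_sum_sdiff B A (fun i => r {i} - r ∅)
  rw [Finset.inter_comm] at hsum
  linarith

/-- The lower modular extension of `r` (from `M = N ∖ {x}` to `N`) is supermodular
on `N` iff `r` is supermodular on `M`. -/
theorem lower_modular_extension
    {α : Type*} [DecidableEq α] (N : Finset α) (hN : 2 ≤ N.card)
    (x : α) (hx : x ∈ N) (M : Finset α) (hM : M = N \ {x})
    (r : Finset α → ℝ) :
    Supermodular N (fun S =>
      if x ∈ S then r (S ∩ M) else r ∅ + ∑ i ∈ S, (r {i} - r ∅)) ↔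
    Supermodular M r := by
  have hsub : ∀ S ⊆ N, x ∉ S → S ⊆ M := fun S hS hxS => by
    rw [hM]
    exact Finset.subset_sdiff.2 ⟨hS, Finset.disjoint_singleton_right.2 hxS⟩
  have hMN : M ⊆ N := hM ▸ Finset.sdiff_subset
  have hxM : x ∉ M := by simp [hM]
  constructor
  · intro h A hA B hB
    have hins : ∀ S ⊆ M, insert x S ∩ M = S := fun S hS => by
      rw [Finset.insert_inter_of_notMem hxM, Finset.inter_eq_left.2 hS]
    have h' := h (insert x A) (Finset.insert_subset hx (hA.trans hMN))
      (insert x B) (Finset.insert_subset hx (hB.trans hMN))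
    rw [← Finset.insert_union_distrib, ← Finset.insert_inter_distrib] at h'
    simpa only [Finset.mem_insert_self, if_true, hins A hA, hins B hB,
      hins _ (Finset.union_subset hA hB),
      hins _ (Finset.inter_subset_left.trans hA)] using h'
  · intro h A hA B hB
    by_cases hxA : x ∈ A <;> by_cases hxB : x ∈ B <;>
      simp only [hxA, hxB, Finset.mem_union, Finset.mem_inter, or_true, or_false,
        and_true, and_false, if_true, if_false]
    · have h' := h (A ∩ M) Finset.inter_subset_right (B ∩ M) Finset.inter_subset_right
      rwa [← Finset.union_inter_distrib_right, ← Finset.inter_inter_distrib_right] at h'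
    · exact h.add_modular_le (hsub B hB hxB)
    · rw [add_comm, Finset.union_comm, Finset.inter_comm A B]
      exact h.add_modular_le (hsub A hA hxA)
    · have := Finset.sum_union_inter (s₁ := A) (s₂ := B) (f := fun i => r {i} - r ∅)
      linarith
end

section
/- Let N be a finite set containing distinct elements x and y, let L := N∖{x,y} and M := L∪{x}. Given a set function r on M, define its lower replication m on N by: m(S) := r((S∩L)∪{x}) if {x,y} ⊆ S, and m(S) := r(S∩L) otherwise. Then: (i) m is supermodular on N if and only if r is supermodular on M and r({x}) ≥ r(∅); (ii) if r belongs to K_ℓ(M) then m belongs to K_ℓ(N), and r generates an extreme ray of the cone K_ℓ(M) if and only if m generates an extreme ray of the cone K_ℓ(N). -/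
/-- The set in `𝒫 (L ∪ {x})` at which the lower replication reads its value on `S`. -/
def collapse {α : Type*} [DecidableEq α] (L : Finset α) (x y : α) (S : Finset α) : Finset α :=
  if x ∈ S ∧ y ∈ S then (S ∩ L) ∪ {x} else S ∩ L

/-- Replace `x` by the pair `{x, y}`; a section of `collapse`. -/
def duplicate {α : Type*} [DecidableEq α] (x y : α) (S : Finset α) : Finset α :=
  if x ∈ S then insert y S else S

section Replication

variable {α : Type*} [DecidableEq α] {L : Finset α} {x y : α}

theorem collapse_subset (S : Finset α) : collapse L x y S ⊆ L ∪ {x} := by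
  intro i
  unfold collapse
  grind

theorem collapse_empty : collapse L x y ∅ = ∅ := by simp [collapse]

theorem collapse_singleton (hxy : x ≠ y) (i : α) :
    collapse L x y {i} = ∅ ∨ i ∈ L ∧ collapse L x y {i} = {i} := by
  unfold collapse
  by_cases hi : i ∈ L
  · right
    rw [if_neg (by grind)]
    exact ⟨hi, by simpa using hi⟩
  · left
    rw [if_neg (by grind)]
    ext j
    grind

theorem collapse_inter (A B : Finset α) :
    collapse L x y (A ∩ B) = collapse L x y A ∩ collapse L x y B := by
  ext i
  unfold collapse
  grind

theorem collapse_union (hxL : x ∉ L) (A B : Finset α) :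
    collapse L x y (A ∪ B) = collapse L x y A ∪ collapse L x y B ∨
      x ∉ collapse L x y A ∪ collapse L x y B ∧
        collapse L x y (A ∪ B) = insert x (collapse L x y A ∪ collapse L x y B) := by
  by_cases h : (x ∈ A ∧ y ∈ A) ∨ (x ∈ B ∧ y ∈ B) ∨ ¬ (x ∈ A ∪ B ∧ y ∈ A ∪ B)
  · left
    ext i
    unfold collapse
    grind
  · right
    simp only [not_or, not_not] at h
    obtain ⟨hA, hB, hAB⟩ := h
    unfold collapse
    rw [if_neg hA, if_neg hB, if_pos hAB]
    refine ⟨by grind, ?_⟩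
    ext i
    grind

theorem duplicate_inter (A B : Finset α) (hA : y ∉ A) (hB : y ∉ B) :
    duplicate x y (A ∩ B) = duplicate x y A ∩ duplicate x y B := by
  ext i
  unfold duplicate
  grind

theorem duplicate_union (A B : Finset α) :
    duplicate x y (A ∪ B) = duplicate x y A ∪ duplicate x y B := by
  ext i
  unfold duplicate
  grind

theorem duplicate_subset {S : Finset α} (hS : S ⊆ L ∪ {x}) : duplicate x y S ⊆ L ∪ {x, y} := by
  intro i
  unfold duplicate
  grind

theorem collapse_duplicate (hyL : y ∉ L) (hxy : x ≠ y) {S : Finset α}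
    (hS : S ⊆ L ∪ {x}) : collapse L x y (duplicate x y S) = S := by
  ext i
  have := @hS i
  unfold collapse duplicate
  grind

theorem duplicate_collapse (hxL : x ∉ L) {S : Finset α} (hS : S ⊆ L ∪ {x, y}) :
    duplicate x y (collapse L x y S) = S ∨
      ∃ i ∈ ({x, y} : Finset α), insert i (duplicate x y (collapse L x y S)) = S := by
  by_cases h : (x ∈ S ↔ y ∈ S)
  · left
    ext i
    have := @hS i
    unfold collapse duplicate
    grind
  · right
    by_cases hx : x ∈ S
    · refine ⟨x, by simp, ?_⟩
      ext i
      have := @hS i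
      unfold collapse duplicate
      grind
    · refine ⟨y, by simp, ?_⟩
      ext i
      have := @hS i
      unfold collapse duplicate
      grind

theorem Supermodular.add_singleton_le {N : Finset α} {m : Finset α → ℝ} (hm : Supermodular N m)
    {i : α} {T : Finset α} (hi : i ∉ T) (hT : insert i T ⊆ N) :
    m T + m {i} ≤ m (insert i T) + m ∅ := by
  have h := hm T (by grind) {i} (by grind)
  rwa [Finset.union_singleton, Finset.inter_singleton_of_notMem hi] at h

theorem Kl.le_insert {N : Finset α} {m : Finset α → ℝ} (hm : Kl N m)
    {i : α} {T : Finset α} (hT : insert i T ⊆ N) : m T ≤ m (insert i T) := by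
  by_cases hi : i ∈ T
  · rw [Finset.insert_eq_of_mem hi]
  · have h := hm.1.add_singleton_le hi hT
    rw [hm.2.1, hm.2.2 i (by grind)] at h
    linarith

theorem Supermodular.comp_collapse (hxL : x ∉ L) {r : Finset α → ℝ}
    (hr : Supermodular (L ∪ {x}) r) (h0 : r ∅ ≤ r {x}) :
    Supermodular (L ∪ {x, y}) (fun S => r (collapse L x y S)) := by
  intro A _ B _
  have h := hr _ (collapse_subset (y := y) A) _ (collapse_subset (y := y) B)
  simp only [collapse_inter]
  rcases collapse_union (y := y) hxL A B with hu | ⟨hn, hu⟩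
  · rwa [hu]
  · have h' := hr.add_singleton_le hn (by rw [← hu]; exact collapse_subset _)
    rw [hu]
    linarith

theorem Supermodular.comp_duplicate (hyL : y ∉ L) (hxy : x ≠ y) {m : Finset α → ℝ}
    (hm : Supermodular (L ∪ {x, y}) m) :
    Supermodular (L ∪ {x}) (fun S => m (duplicate x y S)) := by
  intro A hA B hB
  have h := hm _ (duplicate_subset (y := y) hA) _ (duplicate_subset (y := y) hB)
  simp only [duplicate_union]
  rwa [duplicate_inter A B (fun h => by grind) (fun h => by grind)]

theorem Kl.comp_collapse (hxL : x ∉ L) (hxy : x ≠ y) {r : Finset α → ℝ} (hr : Kl (L ∪ {x}) r) :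
    Kl (L ∪ {x, y}) (fun S => r (collapse L x y S)) := by
  refine ⟨hr.1.comp_collapse hxL (by rw [hr.2.1, hr.2.2 x (by simp)]), ?_, fun i _ => ?_⟩
  · simpa only [collapse_empty] using hr.2.1
  · rcases collapse_singleton (L := L) hxy i with h | ⟨hi, h⟩
    · simpa only [h] using hr.2.1
    · simpa only [h] using hr.2.2 i (by simp [hi])

theorem Kl.comp_duplicate (hyL : y ∉ L) (hxy : x ≠ y) {m : Finset α → ℝ}
    (hm : Kl (L ∪ {x, y}) m) (h0 : m {x, y} = 0) :
    Kl (L ∪ {x}) (fun S => m (duplicate x y S)) := by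
  refine ⟨hm.1.comp_duplicate hyL hxy, by simpa [duplicate] using hm.2.1, fun i hi => ?_⟩
  by_cases h : x = i
  · subst h
    simpa [duplicate, Finset.pair_comm] using h0
  · simpa [duplicate, h] using hm.2.2 i (by grind)

theorem supermodular_comp_collapse_iff (hxL : x ∉ L) (hyL : y ∉ L) (hxy : x ≠ y)
    (r : Finset α → ℝ) :
    Supermodular (L ∪ {x, y}) (fun S => r (collapse L x y S)) ↔
      Supermodular (L ∪ {x}) r ∧ r ∅ ≤ r {x} := by
  refine ⟨fun h => ⟨fun A hA B hB => ?_, ?_⟩, fun h => h.1.comp_collapse hxL h.2⟩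
  · have h' := h.comp_duplicate hyL hxy A hA B hB
    simpa only [collapse_duplicate hyL hxy, hA, hB, Finset.union_subset hA hB,
      Finset.inter_subset_left.trans hA] using h'
  · have h' := h {x} (by grind) {y} (by grind)
    simp [collapse, hxy, hxy.symm, hxL, hyL] at h'
    exact h'

/-- A summand of a lower replication in the cone is itself a lower replication. -/
theorem eq_comp_duplicate_collapse (hxL : x ∉ L) (hyL : y ∉ L) (hxy : x ≠ y)
    {r m₁ m₂ : Finset α → ℝ} (h₁ : Kl (L ∪ {x, y}) m₁) (h₂ : Kl (L ∪ {x, y}) m₂)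
    (hsum : ∀ S ⊆ L ∪ {x, y}, r (collapse L x y S) = m₁ S + m₂ S)
    {S : Finset α} (hS : S ⊆ L ∪ {x, y}) :
    m₁ (duplicate x y (collapse L x y S)) = m₁ S := by
  rcases duplicate_collapse hxL hS with h | ⟨i, _, h⟩
  · rw [h]
  · have hc := collapse_duplicate hyL hxy (collapse_subset (L := L) (x := x) (y := y) S)
    have e := hsum _ (duplicate_subset (y := y) (collapse_subset (L := L) (y := y) S))
    rw [hc, hsum S hS] at e
    have l₁ := h₁.le_insert (by rw [h]; exact hS)
    have l₂ := h₂.le_insert (by rw [h]; exact hS)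
    rw [h] at l₁ l₂
    linarith

theorem extremeRay_comp_collapse_iff (hxL : x ∉ L) (hyL : y ∉ L) (hxy : x ≠ y)
    {r : Finset α → ℝ} (hr : Kl (L ∪ {x}) r) :
    ExtremeRay (L ∪ {x}) (Kl (L ∪ {x})) r ↔
      ExtremeRay (L ∪ {x, y}) (Kl (L ∪ {x, y})) (fun S => r (collapse L x y S)) := by
  have hcd : ∀ {S : Finset α}, S ⊆ L ∪ {x} → collapse L x y (duplicate x y S) = S :=
    collapse_duplicate hyL hxy
  constructor
  · rintro ⟨-, ⟨S, hS, hne⟩, hext⟩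
    refine ⟨hr.comp_collapse hxL hxy, ⟨duplicate x y S, duplicate_subset hS, ?_⟩, ?_⟩
    · simpa only [hcd hS] using hne
    · intro m₁ m₂ h₁ h₂ hsum
      have hsum' : ∀ S ⊆ L ∪ {x, y}, r (collapse L x y S) = m₂ S + m₁ S := fun S hS => by
        rw [add_comm]; exact hsum S hS
      have hpair : m₁ {x, y} = 0 ∧ m₂ {x, y} = 0 := by
        have e := hsum {x, y} (by grind)
        have l₁ := h₁.le_insert (i := x) (T := {y}) (by grind)
        have l₂ := h₂.le_insert (i := x) (T := {y}) (by grind)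
        rw [h₁.2.2 y (by simp)] at l₁
        rw [h₂.2.2 y (by simp)] at l₂
        have c : collapse L x y {x, y} = {x} := by
          ext i
          unfold collapse
          grind
        simp only [c] at e
        rw [hr.2.2 x (by simp)] at e
        constructor <;> linarith
      obtain ⟨a, b, ha, hb, e₁, e₂⟩ := hext _ _ (h₁.comp_duplicate hyL hxy hpair.1)
        (h₂.comp_duplicate hyL hxy hpair.2) (fun S hS => by
          have e := hsum _ (duplicate_subset hS)
          simpa only [hcd hS] using e)
      refine ⟨a, b, ha, hb, fun S hS => ?_, fun S hS => ?_⟩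
      · rw [← eq_comp_duplicate_collapse hxL hyL hxy h₁ h₂ hsum hS]
        exact e₁ _ (collapse_subset S)
      · rw [← eq_comp_duplicate_collapse hxL hyL hxy h₂ h₁ hsum' hS]
        exact e₂ _ (collapse_subset S)
  · rintro ⟨-, ⟨S, hS, hne⟩, hext⟩
    refine ⟨hr, ⟨_, collapse_subset S, hne⟩, fun r₁ r₂ h₁ h₂ hsum => ?_⟩
    obtain ⟨a, b, ha, hb, e₁, e₂⟩ := hext _ _ (h₁.comp_collapse hxL hxy)
      (h₂.comp_collapse hxL hxy) (fun S _ => hsum _ (collapse_subset S))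
    refine ⟨a, b, ha, hb, fun S hS => ?_, fun S hS => ?_⟩
    · simpa only [hcd hS] using e₁ _ (duplicate_subset hS)
    · simpa only [hcd hS] using e₂ _ (duplicate_subset hS)

end Replication

/-- The lower replication of `r : 𝒫(M) → ℝ` (where `L = N∖{x,y}` and `M = L∪{x}`):
`m S = r ((S∩L) ∪ {x})` if `{x,y} ⊆ S`, and `m S = r (S∩L)` otherwise.
(i) `m` is supermodular on `N` iff `r` is supermodular on `M` and `r {x} ≥ r ∅`;
(ii) if `r ∈ K_ℓ(M)` then `m ∈ K_ℓ(N)`, and `r` is extreme in `K_ℓ(M)` iff `m` is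
extreme in `K_ℓ(N)`. -/
theorem lower_replication
    {α : Type*} [DecidableEq α] (N : Finset α) (x y : α)
    (hx : x ∈ N) (hy : y ∈ N) (hxy : x ≠ y)
    (L M : Finset α) (hL : L = N \ {x, y}) (hM : M = L ∪ {x})
    (r : Finset α → ℝ) :
    (Supermodular N (fun S => if x ∈ S ∧ y ∈ S then r ((S ∩ L) ∪ {x}) else r (S ∩ L)) ↔
      (Supermodular M r ∧ r ∅ ≤ r {x})) ∧
    (Kl M r →
      Kl N (fun S => if x ∈ S ∧ y ∈ S then r ((S ∩ L) ∪ {x}) else r (S ∩ L)) ∧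
      (ExtremeRay M (Kl M) r ↔
        ExtremeRay N (Kl N)
          (fun S => if x ∈ S ∧ y ∈ S then r ((S ∩ L) ∪ {x}) else r (S ∩ L)))) := by
  have hxL : x ∉ L := by simp [hL]
  have hyL : y ∉ L := by simp [hL]
  have hN : N = L ∪ {x, y} := by
    rw [hL, Finset.sdiff_union_of_subset (by grind)]
  have hrep : (fun S => if x ∈ S ∧ y ∈ S then r ((S ∩ L) ∪ {x}) else r (S ∩ L)) =
      fun S => r (collapse L x y S) := by
    funext S
    simp only [collapse, apply_ite r]
  clear hL
  subst hM hN
  rw [hrep]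
  exact ⟨supermodular_comp_collapse_iff hxL hyL hxy r,
    fun hr => ⟨hr.comp_collapse hxL hxy, extremeRay_comp_collapse_iff hxL hyL hxy hr⟩⟩
end
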